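/- arXiv:2501.11422 — 6 statements merged into one kernel-verified Lean document; each statement's English description precedes it below -/
import Mathlib

section
/- Let Y be a real symmetric I×I matrix with eigenvalues λ_1 ≥ λ_2 ≥ … ≥ λ_I and corresponding orthonormal eigenvectors u_1, …, u_I, and let E be the number of indices i with λ_i ≥ 0. For any R ≤ I, the matrix S* = Σ_{i=1}^{min(R,E)} λ_i u_i u_iᵀ is positive semi-definite, has rank at most R, and satisfies ‖Y − S*‖ ≤ ‖Y − S‖ for every positive semi-definite matrix S ∈ ℝ^{I×I} with rank(S) ≤ R. -/
open Matrix Finset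

/-- The Frobenius norm of a real matrix. -/
noncomputable def frobNorm {I : ℕ} (A : Matrix (Fin I) (Fin I) ℝ) : ℝ :=
  Real.sqrt (∑ i, ∑ j, (A i j) ^ 2)

/-- The sum of the squares of the entries is invariant under orthogonal changes of bases. -/
theorem sum_sq_orthogonal_mul_mul {n : Type*} [Fintype n] [DecidableEq n]
    {U V : Matrix n n ℝ} (hU : Uᵀ * U = 1) (hV : Vᵀ * V = 1) (A : Matrix n n ℝ) :
    ∑ i, ∑ j, ((Uᵀ * A * V) i j) ^ 2 = ∑ i, ∑ j, (A i j) ^ 2 := by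
  have sum_sq_eq_trace (B : Matrix n n ℝ) : ∑ i, ∑ j, (B i j) ^ 2 = (B * Bᵀ).trace := by
    simp [Matrix.trace, Matrix.mul_apply, sq]
  have hU' : U * Uᵀ = 1 := mul_eq_one_comm.mp hU
  have hV' : V * Vᵀ = 1 := mul_eq_one_comm.mp hV
  rw [sum_sq_eq_trace, sum_sq_eq_trace]
  calc (Uᵀ * A * V * (Uᵀ * A * V)ᵀ).trace
      = (Uᵀ * (A * (V * Vᵀ) * Aᵀ * U)).trace := by
        simp only [transpose_mul, transpose_transpose, Matrix.mul_assoc]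
    _ = (A * Aᵀ * (U * Uᵀ)).trace := by
        rw [trace_mul_comm, hV', Matrix.mul_one, Matrix.mul_assoc]
    _ = (A * Aᵀ).trace := by rw [hU', Matrix.mul_one]

/-- The squared Frobenius distance of two orthogonally diagonalized matrices, in terms of the
eigenvalues and the inner products of the eigenvectors. -/
theorem sum_sq_sub_of_orthogonal_diagonalization {n : Type*} [Fintype n] [DecidableEq n]
    {U V : Matrix n n ℝ} (hU : Uᵀ * U = 1) (hV : Vᵀ * V = 1) (a b : n → ℝ) :
    ∑ i, ∑ j, ((U * diagonal a * Uᵀ - V * diagonal b * Vᵀ) i j) ^ 2 =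
      ∑ i, ∑ j, ((Uᵀ * V) i j) ^ 2 * (a i - b j) ^ 2 := by
  rw [← sum_sq_orthogonal_mul_mul hU hV]
  have h : Uᵀ * (U * diagonal a * Uᵀ - V * diagonal b * Vᵀ) * V =
      diagonal a * (Uᵀ * V) - (Uᵀ * V) * diagonal b := by
    calc _ = (Uᵀ * U) * diagonal a * (Uᵀ * V) - (Uᵀ * V) * diagonal b * (Vᵀ * V) := by
          simp only [Matrix.mul_sub, Matrix.sub_mul, Matrix.mul_assoc]
      _ = _ := by rw [hU, hV, Matrix.one_mul, Matrix.mul_one]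
  rw [h]
  refine Finset.sum_congr rfl fun i _ => Finset.sum_congr rfl fun j _ => ?_
  rw [Matrix.sub_apply, diagonal_mul, mul_diagonal]
  ring

/-- The rows of an orthogonal matrix are unit vectors. -/
theorem sum_sq_row_eq_one {n : Type*} [Fintype n] [DecidableEq n]
    {Q : Matrix n n ℝ} (hQ : Q * Qᵀ = 1) (i : n) : ∑ j, (Q i j) ^ 2 = 1 := by
  simpa [Matrix.mul_apply, sq] using congrFun (congrFun hQ i) i

/-- The columns of an orthogonal matrix are unit vectors. -/
theorem sum_sq_col_eq_one {n : Type*} [Fintype n] [DecidableEq n]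
    {Q : Matrix n n ℝ} (hQ : Qᵀ * Q = 1) (j : n) : ∑ i, (Q i j) ^ 2 = 1 := by
  simpa [Matrix.mul_apply, sq] using congrFun (congrFun hQ j) j

/-- A nonincreasing nonnegative sequence, weighted by weights in `[0, 1]` of total mass at most
`R`, sums to at most the sum of its first `R` terms. -/
theorem sum_mul_le_sum_initial {I R : ℕ} (hR : R ≤ I) {a p : Fin I → ℝ}
    (ha : Antitone a) (ha0 : ∀ i, 0 ≤ a i) (hp0 : ∀ i, 0 ≤ p i) (hp1 : ∀ i, p i ≤ 1)
    (hp : ∑ i, p i ≤ R) :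
    ∑ i, a i * p i ≤ ∑ i : Fin I, if (i : ℕ) < R then a i else 0 := by
  obtain ⟨t, ht0, hlt, hge⟩ : ∃ t : ℝ, 0 ≤ t ∧ (∀ i : Fin I, (i : ℕ) < R → t ≤ a i) ∧
      ∀ i : Fin I, ¬ (i : ℕ) < R → a i ≤ t := by
    rcases hR.lt_or_eq with h | h
    · exact ⟨a ⟨R, h⟩, ha0 _, fun i hi => ha (Fin.le_def.mpr hi.le),
        fun i hi => ha (Fin.le_def.mpr (not_lt.mp hi))⟩
    · exact ⟨0, le_rfl, fun i _ => ha0 i, fun i hi => absurd (h ▸ i.isLt) hi⟩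
  have hcard : ∑ i : Fin I, (if (i : ℕ) < R then (1 : ℝ) else 0) = R := by
    rw [Finset.sum_boole, Fin.card_filter_val_lt, min_eq_right hR]
  have hterm (i : Fin I) : a i * p i ≤
      (if (i : ℕ) < R then a i else 0) + t * (p i - if (i : ℕ) < R then 1 else 0) := by
    split_ifs with hi
    · nlinarith [mul_nonneg (sub_nonneg.mpr (hlt i hi)) (sub_nonneg.mpr (hp1 i))]
    · nlinarith [mul_nonneg (sub_nonneg.mpr (hge i hi)) (hp0 i)]
  calc ∑ i, a i * p i ≤ _ := Finset.sum_le_sum fun i _ => hterm i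
    _ = (∑ i : Fin I, if (i : ℕ) < R then a i else 0) + t * (∑ i, p i - R) := by
        rw [Finset.sum_add_distrib, ← Finset.mul_sum, Finset.sum_sub_distrib, hcard]
    _ ≤ _ := by nlinarith

/-- A real positive semi-definite matrix is orthogonally diagonalizable, with nonnegative
eigenvalues of which exactly `rank` many are nonzero. -/
theorem Matrix.PosSemidef.exists_orthogonal_diagonalization {n : Type*} [Fintype n]
    [DecidableEq n] {S : Matrix n n ℝ} (hS : S.PosSemidef) :
    ∃ (V : Matrix n n ℝ) (b : n → ℝ), Vᵀ * V = 1 ∧ S = V * diagonal b * Vᵀ ∧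
      (∀ i, 0 ≤ b i) ∧ #{i | b i ≠ 0} = S.rank := by
  refine ⟨hS.1.eigenvectorUnitary, hS.1.eigenvalues, ?_, ?_, hS.eigenvalues_nonneg, ?_⟩
  · rw [← conjTranspose_eq_transpose_of_trivial]
    exact Unitary.coe_star_mul_self hS.1.eigenvectorUnitary
  · conv_lhs => rw [hS.1.spectral_theorem]
    rw [← conjTranspose_eq_transpose_of_trivial]
    rfl
  · rw [hS.1.rank_eq_card_non_zero_eigs, Fintype.card_subtype]

/-- The nonnegative terms of a nonincreasing sequence are its initial ones. -/
theorem lt_card_nonneg_iff {I : ℕ} {a : Fin I → ℝ} (ha : Antitone a) (i : Fin I) :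
    (i : ℕ) < #{j | 0 ≤ a j} ↔ 0 ≤ a i := by
  constructor
  · intro h
    by_contra hi
    have hsub : ({j | 0 ≤ a j} : Finset (Fin I)) ⊆ Finset.Iio i := fun j hj => by
      rw [Finset.mem_Iio]
      by_contra hij
      exact hi ((Finset.mem_filter.mp hj).2.trans (ha (not_lt.mp hij)))
    have := Finset.card_le_card hsub
    rw [Fin.card_Iio] at this
    omega
  · intro hi
    have hsub : Finset.Iic i ⊆ ({j | 0 ≤ a j} : Finset (Fin I)) := fun j hj =>
      Finset.mem_filter.mpr ⟨Finset.mem_univ j, hi.trans (ha (Finset.mem_Iic.mp hj))⟩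
    have := Finset.card_le_card hsub
    rw [Fin.card_Iic] at this
    omega

/-- Lower bound for the squared Frobenius distance of an orthogonally diagonalized matrix to a
positive semi-definite matrix of rank at most `R`. -/
theorem sum_sq_sub_ge_of_posSemidef {I R : ℕ} (hR : R ≤ I) {U S : Matrix (Fin I) (Fin I) ℝ}
    {a : Fin I → ℝ} (hU : Uᵀ * U = 1) (ha : Antitone a) (hS : S.PosSemidef)
    (hrank : S.rank ≤ R) :
    ∑ i, (a i) ^ 2 - ∑ i : Fin I, (if (i : ℕ) < R then (max (a i) 0) ^ 2 else 0) ≤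
      ∑ i, ∑ j, ((U * diagonal a * Uᵀ - S) i j) ^ 2 := by
  obtain ⟨V, b, hV, hSV, hb, hcard⟩ := hS.exists_orthogonal_diagonalization
  rw [hSV, sum_sq_sub_of_orthogonal_diagonalization hU hV]
  set Q := Uᵀ * V with hQ
  have hQQ' : Q * Qᵀ = 1 := by
    rw [hQ, transpose_mul, transpose_transpose, Matrix.mul_assoc, ← Matrix.mul_assoc V,
      mul_eq_one_comm.mp hV, Matrix.one_mul, hU]
  have hQ'Q : Qᵀ * Q = 1 := mul_eq_one_comm.mp hQQ'
  set p : Fin I → ℝ := fun i => ∑ j with b j ≠ 0, (Q i j) ^ 2 with hp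
  have hp1 (i : Fin I) : p i ≤ 1 := by
    rw [← sum_sq_row_eq_one hQQ' i]
    exact Finset.sum_le_sum_of_subset_of_nonneg (Finset.filter_subset _ _)
      fun _ _ _ => sq_nonneg _
  have hpsum : ∑ i, p i ≤ R := by
    rw [hp, Finset.sum_comm, Finset.sum_congr rfl fun j _ => sum_sq_col_eq_one hQ'Q j]
    rw [Finset.sum_const, nsmul_eq_mul, mul_one, hcard]
    exact_mod_cast hrank
  have hbound := sum_mul_le_sum_initial hR (a := fun i => (max (a i) 0) ^ 2) (p := p)
    (fun i j hij => pow_le_pow_left₀ (le_max_right _ _) (max_le_max_right 0 (ha hij)) 2)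
    (fun i => sq_nonneg _) (fun i => Finset.sum_nonneg fun _ _ => sq_nonneg _) hp1 hpsum
  have hterm (i j : Fin I) : (Q i j) ^ 2 * (a i) ^ 2 -
      (max (a i) 0) ^ 2 * (if b j ≠ 0 then (Q i j) ^ 2 else 0) ≤
      (Q i j) ^ 2 * (a i - b j) ^ 2 := by
    split_ifs with hj
    · have : (a i) ^ 2 - (max (a i) 0) ^ 2 ≤ (a i - b j) ^ 2 := by
        rcases le_total 0 (a i) with h | h
        · rw [max_eq_left h]
          nlinarith [sq_nonneg (a i - b j)]
        · rw [max_eq_right h]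
          nlinarith [mul_nonneg (neg_nonneg.mpr h) (hb j), sq_nonneg (b j)]
      nlinarith [mul_le_mul_of_nonneg_left this (sq_nonneg (Q i j))]
    · rw [not_not.mp hj]
      simp
  calc _ ≤ ∑ i, (a i) ^ 2 - ∑ i, (max (a i) 0) ^ 2 * p i := by linarith
    _ = ∑ i, ∑ j, ((Q i j) ^ 2 * (a i) ^ 2 -
          (max (a i) 0) ^ 2 * (if b j ≠ 0 then (Q i j) ^ 2 else 0)) := by
        rw [← Finset.sum_sub_distrib]
        refine Finset.sum_congr rfl fun i _ => ?_
        rw [Finset.sum_sub_distrib, ← Finset.sum_mul, sum_sq_row_eq_one hQQ' i, one_mul,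
          ← Finset.mul_sum, ← Finset.sum_filter]
    _ ≤ _ := Finset.sum_le_sum fun i _ => Finset.sum_le_sum fun j _ => hterm i j

/-- Best positive semi-definite approximation of bounded rank. -/
theorem stmt0 (I R : ℕ) (hR : R ≤ I)
    (Y U : Matrix (Fin I) (Fin I) ℝ) (lam : Fin I → ℝ)
    (hsym : Yᵀ = Y)
    (hU : Uᵀ * U = 1)
    (hdecomp : Y = U * Matrix.diagonal lam * Uᵀ)
    (hmono : Antitone lam)
    (E : ℕ) (hE : E = (Finset.univ.filter fun i : Fin I => 0 ≤ lam i).card)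
    (Sstar : Matrix (Fin I) (Fin I) ℝ)
    (hS : Sstar = ∑ i ∈ Finset.univ.filter (fun i : Fin I => (i : ℕ) < min R E),
        lam i • vecMulVec (fun j => U j i) (fun j => U j i)) :
    Sstar.PosSemidef ∧ Sstar.rank ≤ R ∧
      ∀ S : Matrix (Fin I) (Fin I) ℝ, S.PosSemidef → S.rank ≤ R →
        frobNorm (Y - Sstar) ≤ frobNorm (Y - S) := by
  set c : Fin I → ℝ := fun i => if (i : ℕ) < R then max (lam i) 0 else 0 with hc
  have hSU : Sstar = U * diagonal c * Uᵀ := by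
    ext j k
    rw [hS, Matrix.sum_apply, Finset.sum_filter, Matrix.mul_apply]
    refine Finset.sum_congr rfl fun i _ => ?_
    have hci : c i = if (i : ℕ) < min R E then lam i else 0 := by
      have hiff : (i : ℕ) < E ↔ 0 ≤ lam i := hE ▸ lt_card_nonneg_iff hmono i
      simp only [hc, lt_min_iff, hiff]
      by_cases h0 : 0 ≤ lam i
      · simp [h0]
      · simp [h0, (not_le.mp h0).le]
    rw [mul_diagonal, hci, transpose_apply]
    split_ifs
    · rw [Matrix.smul_apply, vecMulVec_apply, smul_eq_mul]
      ring
    · simp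
  have hc0 : 0 ≤ c := fun i => by
    simp only [hc, Pi.zero_apply]
    split_ifs
    exacts [le_max_right _ _, le_rfl]
  refine ⟨?_, ?_, fun S hSpsd hrank => Real.sqrt_le_sqrt ?_⟩
  · rw [hSU, ← conjTranspose_eq_transpose_of_trivial]
    exact (PosSemidef.diagonal hc0).mul_mul_conjTranspose_same U
  · calc Sstar.rank ≤ (diagonal c).rank := by
          rw [hSU]
          exact (rank_mul_le_left _ _).trans (rank_mul_le_right _ _)
      _ = #{i | c i ≠ 0} := by rw [rank_diagonal, Fintype.card_subtype]
      _ ≤ #{i : Fin I | (i : ℕ) < R} := Finset.card_le_card fun i hi => by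
          simp only [hc, Finset.mem_filter, Finset.mem_univ, true_and] at hi ⊢
          by_contra h
          exact hi (if_neg h)
      _ ≤ R := by rw [Fin.card_filter_val_lt]; exact min_le_right _ _
  · have hge := sum_sq_sub_ge_of_posSemidef hR hU hmono hSpsd hrank
    rw [← hdecomp, ← Finset.sum_sub_distrib] at hge
    refine le_trans (le_of_eq ?_) hge
    rw [hdecomp, hSU, sum_sq_sub_of_orthogonal_diagonalization hU hU, hU]
    refine Finset.sum_congr rfl fun i _ => ?_
    rw [Finset.sum_eq_single i (fun j _ hj => by simp [Matrix.one_apply_ne hj.symm])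
      (fun h => absurd (Finset.mem_univ i) h), Matrix.one_apply_eq]
    simp only [hc]
    split_ifs
    · rcases le_total 0 (lam i) with h | h
      · simp [h]
      · simp [h]
    · ring
end

section
/- Let A and B be real symmetric n×n matrices with eigenvalues α_1 ≥ α_2 ≥ … ≥ α_n and β_1 ≥ β_2 ≥ … ≥ β_n, respectively. Then tr(AB) ≤ Σ_{i=1}^n α_i β_i. -/
open Matrix Finset

/-- A doubly stochastic matrix cannot increase the pairing of two similarly ordered vectors. -/
theorem Monovary.dotProduct_mulVec_le_of_mem_doublyStochastic {ι : Type*} [Fintype ι]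
    [DecidableEq ι] {f g : ι → ℝ} (hfg : Monovary f g) {M : Matrix ι ι ℝ}
    (hM : M ∈ doublyStochastic ℝ ι) : f ⬝ᵥ M *ᵥ g ≤ f ⬝ᵥ g := by
  obtain ⟨w, hw_nonneg, hw_sum, rfl⟩ := exists_eq_sum_perm_of_mem_doublyStochastic hM
  calc f ⬝ᵥ (∑ σ, w σ • σ.permMatrix ℝ) *ᵥ g
      = ∑ σ, w σ * (f ⬝ᵥ (g ∘ σ)) := by
        simp [Matrix.sum_mulVec, dotProduct_sum, smul_mulVec, permMatrix_mulVec]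
    _ ≤ ∑ σ, w σ * (f ⬝ᵥ g) := by
        gcongr with σ
        · exact hw_nonneg σ
        · exact hfg.sum_mul_comp_perm_le_sum_mul
    _ = f ⬝ᵥ g := by rw [← Finset.sum_mul, hw_sum, one_mul]

/-- The entrywise square of a real orthogonal matrix is doubly stochastic. -/
theorem Matrix.hadamard_self_mem_doublyStochastic {ι : Type*} [Fintype ι] [DecidableEq ι]
    {W : Matrix ι ι ℝ} (hW : Wᵀ * W = 1) : W ⊙ W ∈ doublyStochastic ℝ ι := by
  refine mem_doublyStochastic_iff_sum.2 ⟨fun i j => mul_self_nonneg _, fun i => ?_, fun j => ?_⟩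
  · simpa [mul_apply] using Matrix.ext_iff.2 (mul_eq_one_comm.1 hW) i i
  · simpa [mul_apply] using Matrix.ext_iff.2 hW j j

/-- The trace of a product of two orthogonally diagonalized matrices. -/
theorem Matrix.trace_conj_diagonal_mul_conj_diagonal {ι : Type*} [Fintype ι] [DecidableEq ι]
    (P Q : Matrix ι ι ℝ) (α β : ι → ℝ) :
    (P * diagonal α * Pᵀ * (Q * diagonal β * Qᵀ)).trace =
      α ⬝ᵥ ((Pᵀ * Q) ⊙ (Pᵀ * Q)) *ᵥ β := by
  calc (P * diagonal α * Pᵀ * (Q * diagonal β * Qᵀ)).trace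
      = (diagonal α * ((Pᵀ * Q) * diagonal β * (Pᵀ * Q)ᵀ)).trace := by
        rw [Matrix.mul_assoc P, Matrix.mul_assoc P, trace_mul_comm P, transpose_mul,
          transpose_transpose]
        simp only [Matrix.mul_assoc]
    _ = α ⬝ᵥ ((Pᵀ * Q) ⊙ (Pᵀ * Q)) *ᵥ β := by
        generalize Pᵀ * Q = W
        simp only [trace, diag_apply, diagonal_mul, dotProduct, mulVec, hadamard_apply]
        refine Finset.sum_congr rfl fun i _ => ?_
        rw [mul_apply]
        simp only [mul_diagonal, transpose_apply]
        congr 1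
        exact Finset.sum_congr rfl fun j _ => by ring

/-- Von Neumann-type trace inequality for symmetric matrices (Theobald):
`tr(AB) ≤ Σ αᵢ βᵢ` for eigenvalues listed in nonincreasing order. -/
theorem stmt2 (n : ℕ) (A B P Q : Matrix (Fin n) (Fin n) ℝ) (α β : Fin n → ℝ)
    (hAsym : Aᵀ = A) (hBsym : Bᵀ = B)
    (hP : Pᵀ * P = 1) (hQ : Qᵀ * Q = 1)
    (hA : A = P * Matrix.diagonal α * Pᵀ) (hB : B = Q * Matrix.diagonal β * Qᵀ)
    (hα : Antitone α) (hβ : Antitone β) :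
    (A * B).trace ≤ ∑ i, α i * β i := by
  have hW : (Pᵀ * Q)ᵀ * (Pᵀ * Q) = 1 := by
    rw [transpose_mul, transpose_transpose, Matrix.mul_assoc, ← Matrix.mul_assoc P,
      mul_eq_one_comm.1 hP, Matrix.one_mul, hQ]
  rw [hA, hB, trace_conj_diagonal_mul_conj_diagonal]
  exact (hα.monovary hβ).dotProduct_mulVec_le_of_mem_doublyStochastic
    (hadamard_self_mem_doublyStochastic hW)
end

section
/- Let S^(1), …, S^(K) be real symmetric I×I matrices, and consider the feasible set F of pairs (U, a) with U ∈ ℝ^{I×R}, UᵀU = I_R, a ∈ ℝ^K with all entries nonnegative and ‖a‖ = 1. A pair (U, a) ∈ F maximizes Σ_{k=1}^K a_k · tr(Uᵀ S^(k) U) over F if and only if it minimizes Σ_{k=1}^K ‖S^(k) − a_k · UUᵀ‖² over F. -/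
open Matrix Finset

/-- The sum of squared entries of a matrix is `tr (Mᵀ M)`. -/
theorem sum_sq_eq_trace_transpose_mul {m n : Type*} [Fintype m] [Fintype n]
    (M : Matrix m n ℝ) : ∑ i, ∑ j, M i j ^ 2 = (Mᵀ * M).trace := by
  simp only [trace, diag_apply, mul_apply, transpose_apply, ← sq]
  exact Finset.sum_comm

/-- Squared Frobenius distance from `S` to a multiple of the projection `V Vᵀ`. -/
theorem sum_sq_sub_smul_projection {m n : Type*} [Fintype m] [Fintype n] [DecidableEq n]
    (S : Matrix m m ℝ) (V : Matrix m n ℝ) (hV : Vᵀ * V = 1) (c : ℝ) :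
    ∑ i, ∑ j, ((S - c • (V * Vᵀ)) i j) ^ 2 =
      (Sᵀ * S).trace - 2 * (c * (Vᵀ * S * V).trace) + c ^ 2 * Fintype.card n := by
  have hcross : (V * Vᵀ * S).trace = (Vᵀ * S * V).trace := by
    rw [Matrix.mul_assoc, trace_mul_comm]
  have hcross' : (Sᵀ * (V * Vᵀ)).trace = (Vᵀ * S * V).trace := by
    rw [← hcross, ← trace_transpose (V * Vᵀ * S)]
    simp
  have hproj : (V * Vᵀ * (V * Vᵀ)).trace = Fintype.card n := by
    rw [Matrix.mul_assoc, ← Matrix.mul_assoc Vᵀ, hV, Matrix.one_mul, trace_mul_comm, hV,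
      trace_one]
  rw [sum_sq_eq_trace_transpose_mul]
  simp only [transpose_sub, transpose_smul, transpose_mul, transpose_transpose, Matrix.sub_mul,
    Matrix.mul_sub, Matrix.smul_mul, Matrix.mul_smul, trace_sub, trace_smul, smul_eq_mul,
    hcross, hcross', hproj]
  ring

/-- For a unit vector `b` and orthonormal `V`, the fitting error is a constant minus twice the
trace objective. -/
theorem sum_sum_sq_sub_smul_projection {ι m n : Type*} [Fintype ι] [Fintype m] [Fintype n]
    [DecidableEq n] (S : ι → Matrix m m ℝ) (V : Matrix m n ℝ) (b : EuclideanSpace ℝ ι)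
    (hV : Vᵀ * V = 1) (hb : ‖b‖ = 1) :
    ∑ k, ∑ i, ∑ j, ((S k - b k • (V * Vᵀ)) i j) ^ 2 =
      ∑ k, ((S k)ᵀ * S k).trace - 2 * ∑ k, b k * (Vᵀ * S k * V).trace + Fintype.card n := by
  have hsq : ∑ k, b k ^ 2 = 1 := by
    rw [← EuclideanSpace.real_norm_sq_eq, hb, one_pow]
  simp only [sum_sq_sub_smul_projection _ V hV, sum_add_distrib, sum_sub_distrib, ← mul_sum,
    ← sum_mul, hsq, one_mul]

/-- Over the feasible set of pairs `(U, a)` with orthonormal `U`, entrywise-nonnegative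
unit vector `a`, maximizing `Σₖ aₖ tr(Uᵀ S⁽ᵏ⁾ U)` is equivalent to minimizing
`Σₖ ‖S⁽ᵏ⁾ − aₖ·UUᵀ‖²`. -/
theorem stmt4 (I R K : ℕ) (S : Fin K → Matrix (Fin I) (Fin I) ℝ)
    (hS : ∀ k, (S k)ᵀ = S k)
    (U : Matrix (Fin I) (Fin R) ℝ) (a : EuclideanSpace ℝ (Fin K))
    (hU : Uᵀ * U = 1) (ha0 : ∀ k, 0 ≤ a k) (ha1 : ‖a‖ = 1) :
    (∀ (V : Matrix (Fin I) (Fin R) ℝ) (b : EuclideanSpace ℝ (Fin K)),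
        Vᵀ * V = 1 → (∀ k, 0 ≤ b k) → ‖b‖ = 1 →
        (∑ k, b k * (Vᵀ * S k * V).trace) ≤ ∑ k, a k * (Uᵀ * S k * U).trace)
      ↔
    (∀ (V : Matrix (Fin I) (Fin R) ℝ) (b : EuclideanSpace ℝ (Fin K)),
        Vᵀ * V = 1 → (∀ k, 0 ≤ b k) → ‖b‖ = 1 →
        (∑ k, ∑ i, ∑ j, ((S k - a k • (U * Uᵀ)) i j) ^ 2) ≤
          ∑ k, ∑ i, ∑ j, ((S k - b k • (V * Vᵀ)) i j) ^ 2) := by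
  refine forall₅_congr fun V b hV _ hb => ?_
  rw [sum_sum_sq_sub_smul_projection S U a hU ha1, sum_sum_sq_sub_smul_projection S V b hV hb]
  constructor <;> intro h <;> linarith
end

section
/- Let U ∈ ℝ^{I×R} satisfy UᵀU = I_R, let D ∈ ℝ^{R×R} be diagonal, let a ∈ ℝ^K with a ≠ 0, and let Y_1, …, Y_K ∈ ℝ^{I×I} be symmetric. Define Z = (1/‖a‖) Σ_{k=1}^K a_k Y_k. Then Σ_{k=1}^K ‖Y_k − a_k · U D Uᵀ‖² = Σ_{k=1}^K ‖Y_k‖² − ‖Z‖² + ‖Z − ‖a‖·U D Uᵀ‖². -/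
open Matrix Finset

/-- Completing the square: the residual of fitting `y` by `m • a` splits off the residual of the
normalized projection `⟪a, y⟫ / ‖a‖`. -/
theorem sum_sub_mul_sq_eq {ι : Type*} [Fintype ι] (a : EuclideanSpace ℝ ι) (ha : a ≠ 0)
    (y : ι → ℝ) (m : ℝ) :
    ∑ k, (y k - a k * m) ^ 2 =
      ∑ k, y k ^ 2 - (1 / ‖a‖ * ∑ k, a k * y k) ^ 2
        + (1 / ‖a‖ * ∑ k, a k * y k - ‖a‖ * m) ^ 2 := by
  have hna : ‖a‖ ≠ 0 := norm_ne_zero_iff.mpr ha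
  have expand : ∑ k, (y k - a k * m) ^ 2 =
      ∑ k, y k ^ 2 - 2 * m * ∑ k, a k * y k + m ^ 2 * ∑ k, a k ^ 2 := by
    rw [Finset.mul_sum, Finset.mul_sum, ← Finset.sum_sub_distrib, ← Finset.sum_add_distrib]
    exact Finset.sum_congr rfl fun k _ => by ring
  rw [expand, ← EuclideanSpace.real_norm_sq_eq a]
  field_simp
  ring

/-- With `Z = (1/‖a‖) Σₖ aₖ Yₖ`, one has
`Σₖ ‖Yₖ − aₖ·U D Uᵀ‖² = Σₖ ‖Yₖ‖² − ‖Z‖² + ‖Z − ‖a‖·U D Uᵀ‖²`. -/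
theorem stmt6 (I R K : ℕ) (U : Matrix (Fin I) (Fin R) ℝ) (hU : Uᵀ * U = 1)
    (D : Matrix (Fin R) (Fin R) ℝ) (hD : D.IsDiag)
    (a : EuclideanSpace ℝ (Fin K)) (ha : a ≠ 0)
    (Y : Fin K → Matrix (Fin I) (Fin I) ℝ)
    (hY : ∀ k, (Y k)ᵀ = Y k)
    (Z : Matrix (Fin I) (Fin I) ℝ)
    (hZ : Z = (1 / ‖a‖) • ∑ k, a k • Y k) :
    (∑ k, ∑ i, ∑ j, ((Y k - a k • (U * D * Uᵀ)) i j) ^ 2) =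
      (∑ k, ∑ i, ∑ j, (Y k i j) ^ 2) - (∑ i, ∑ j, (Z i j) ^ 2)
        + ∑ i, ∑ j, ((Z - ‖a‖ • (U * D * Uᵀ)) i j) ^ 2 := by
  have sum_rotate (f : Fin K → Fin I → Fin I → ℝ) :
      ∑ k, ∑ i, ∑ j, f k i j = ∑ i, ∑ j, ∑ k, f k i j := by
    rw [Finset.sum_comm]
    exact Finset.sum_congr rfl fun i _ => Finset.sum_comm
  rw [sum_rotate, sum_rotate]
  simp only [← Finset.sum_sub_distrib, ← Finset.sum_add_distrib]
  refine Finset.sum_congr rfl fun i _ => Finset.sum_congr rfl fun j _ => ?_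
  simpa [hZ, Matrix.sum_apply] using
    sum_sub_mul_sq_eq a ha (fun k => Y k i j) ((U * D * Uᵀ) i j)
end

section
/- Let Z^(1), …, Z^(M) be real symmetric I×I matrices and let R ≤ M·I. Then the supremum, over all nonnegative integers R_1, …, R_M with R_1 + … + R_M = R and R_m ≤ I for each m, and over all matrices U^(m) ∈ ℝ^{I×R_m} with (U^(m))ᵀU^(m) = I_{R_m}, of Σ_{m=1}^M tr((U^(m))ᵀ Z^(m) U^(m)), equals the sum of the R largest elements of the multiset union (with multiplicity) of the eigenvalues of Z^(1), …, Z^(M). -/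
open Matrix Finset

/-- The sum left after dropping the `k` smallest values of `f` is the sum of `f` over a set of
indices that a threshold `t` separates from its complement. -/
theorem exists_threshold_finset {ι : Type*} [Fintype ι] [DecidableEq ι] (f : ι → ℝ) (k : ℕ)
    (hk : k ≤ Fintype.card ι) :
    ∃ (T : Finset ι) (t : ℝ), T.card = Fintype.card ι - k ∧ (∀ i ∈ T, t ≤ f i) ∧
      (∀ i ∉ T, f i ≤ t) ∧
      (((univ.val.map f).sort (· ≤ ·)).drop k).sum = ∑ i ∈ T, f i := by
  obtain ⟨n, e, hmono⟩ : ∃ (n : ℕ) (e : Fin n ≃ ι), Monotone (f ∘ e) :=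
    ⟨_, (Tuple.sort (f ∘ (Fintype.equivFin ι).symm)).trans (Fintype.equivFin ι).symm,
      Tuple.monotone_sort (f ∘ (Fintype.equivFin ι).symm)⟩
  obtain rfl : n = Fintype.card ι := by simpa using Fintype.card_congr e
  have hsort : (univ.val.map f).sort (· ≤ ·) = List.ofFn (f ∘ e) := by
    refine List.Perm.eq_of_pairwise (le := (· ≤ ·)) (fun _ _ _ _ => le_antisymm)
      (Multiset.pairwise_sort _ _) ?_ ?_
    · exact hmono.sortedLE_ofFn.pairwise
    · rw [← Multiset.coe_eq_coe, Multiset.sort_eq, ← Finset.map_univ_equiv e]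
      simp [Fin.univ_def, List.ofFn_eq_map, Function.comp_def]
  refine ⟨(univ.filter fun i : Fin (Fintype.card ι) => k ≤ i).map e.toEmbedding, ?_⟩
  have hmem : ∀ i, i ∈ (univ.filter fun i : Fin (Fintype.card ι) => k ≤ i).map e.toEmbedding ↔
      k ≤ e.symm i := by
    intro i
    simp only [Finset.mem_map_equiv, mem_filter, mem_univ, true_and]
  have hcard : ((univ.filter fun i : Fin (Fintype.card ι) => k ≤ i).map e.toEmbedding).card =
      Fintype.card ι - k := by
    have h := Finset.card_filter_add_card_filter_not (s := (univ : Finset (Fin (Fintype.card ι))))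
      (fun i => (i : ℕ) < k)
    simp only [Fin.card_filter_val_lt, not_lt, card_univ, Fintype.card_fin] at h
    rw [Finset.card_map]
    omega
  have hsum : (((univ.val.map f).sort (· ≤ ·)).drop k).sum =
      ∑ i ∈ (univ.filter fun i : Fin (Fintype.card ι) => k ≤ i).map e.toEmbedding, f i := by
    have h := Finset.sum_filter_add_sum_filter_not (univ : Finset (Fin (Fintype.card ι)))
      (fun i => (i : ℕ) < k) (f ∘ e)
    have h2 := List.sum_take_add_sum_drop (List.ofFn (f ∘ e)) k
    rw [List.sum_take_ofFn, List.sum_ofFn] at h2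
    simp only [not_lt] at h
    rw [hsort, Finset.sum_map]
    simp only [Function.comp_apply, Equiv.coe_toEmbedding] at h h2 ⊢
    linarith
  rcases hk.lt_or_eq with hlt | heq
  · refine ⟨f (e ⟨k, hlt⟩), hcard, fun i hi => ?_, fun i hi => ?_, hsum⟩
    · simpa using @hmono ⟨k, hlt⟩ (e.symm i) ((hmem i).1 hi)
    · rw [hmem, not_le] at hi
      simpa using @hmono (e.symm i) ⟨k, hlt⟩ hi.le
  · obtain ⟨t, ht⟩ := (Set.finite_range f).bddAbove
    refine ⟨t, hcard, fun i hi => ?_, fun i _ => ht ⟨i, rfl⟩, hsum⟩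
    have := (hmem i).1 hi
    have := (e.symm i).2
    omega

/-- A weighted sum with weights in `[0, 1]` of total mass `T.card` is at most the sum over `T`,
if `T` is separated from its complement by a threshold. -/
theorem sum_mul_le_sum_of_threshold {ι : Type*} [Fintype ι] [DecidableEq ι] (f w : ι → ℝ)
    (T : Finset ι) (t : ℝ) (hT : ∀ i ∈ T, t ≤ f i) (hTc : ∀ i ∉ T, f i ≤ t)
    (hw0 : ∀ i, 0 ≤ w i) (hw1 : ∀ i, w i ≤ 1) (hw : ∑ i, w i = T.card) :
    ∑ i, f i * w i ≤ ∑ i ∈ T, f i := by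
  have h : 0 ≤ ∑ i, (f i - t) * ((if i ∈ T then 1 else 0) - w i) := by
    refine Finset.sum_nonneg fun i _ => ?_
    split_ifs with hi
    · exact mul_nonneg (sub_nonneg.2 (hT i hi)) (sub_nonneg.2 (hw1 i))
    · exact mul_nonneg_of_nonpos_of_nonpos (sub_nonpos.2 (hTc i hi)) (by simpa using hw0 i)
  have h2 : ∑ i, (f i - t) * ((if i ∈ T then 1 else 0) - w i) =
      ∑ i ∈ T, f i - t * T.card - (∑ i, f i * w i - t * ∑ i, w i) := by
    simp only [mul_sub, sub_mul, Finset.sum_sub_distrib, ← Finset.mul_sum, mul_ite, mul_one,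
      mul_zero, Finset.sum_ite_mem, Finset.univ_inter, Finset.sum_const, nsmul_eq_mul]
    ring
  rw [h2, hw] at h
  linarith

/-- The rows of a real matrix with orthonormal columns have norm at most one. -/
theorem mul_transpose_diag_le_one {m n : Type*} [Fintype m] [Fintype n] [DecidableEq n]
    (V : Matrix m n ℝ) (hV : Vᵀ * V = 1) (i : m) : (V * Vᵀ) i i ≤ 1 := by
  have hidem : (V * Vᵀ) * (V * Vᵀ)ᵀ = V * Vᵀ := by
    rw [transpose_mul, transpose_transpose, Matrix.mul_assoc, ← Matrix.mul_assoc Vᵀ, hV,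
      Matrix.one_mul]
  have h : (V * Vᵀ) i i = ∑ j, (V * Vᵀ) i j * (V * Vᵀ) i j := by
    conv_lhs => rw [← hidem, Matrix.mul_apply]
    rfl
  have h2 := Finset.single_le_sum (f := fun j => (V * Vᵀ) i j * (V * Vᵀ) i j)
    (fun j _ => mul_self_nonneg _) (mem_univ i)
  simp only [← h] at h2
  nlinarith

theorem mul_transpose_diag_nonneg {m n : Type*} [Fintype n] (V : Matrix m n ℝ) (i : m) :
    0 ≤ (V * Vᵀ) i i :=
  Finset.sum_nonneg fun _ _ => mul_self_nonneg _

theorem trace_transpose_mul_diagonal_mul {m n : Type*} [Fintype m] [DecidableEq m] [Fintype n]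
    (V : Matrix m n ℝ) (d : m → ℝ) :
    (Vᵀ * diagonal d * V).trace = ∑ i, d i * (V * Vᵀ) i i := by
  rw [Matrix.mul_assoc, Matrix.trace_mul_comm, Matrix.mul_assoc]
  simp [Matrix.trace, Matrix.diagonal_mul]

theorem multiset_map_eq_sum_singleton {δ γ : Type*} (s : Finset δ) (g : δ → γ) :
    s.val.map g = ∑ i ∈ s, {g i} := by
  rw [← Multiset.sum_map_singleton (s.val.map g), Multiset.map_map]
  rfl

theorem sum_multiset_map_eq_map_prod {α β γ : Type*} [Fintype α] [Fintype β] (f : α → β → γ) :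
    (∑ a, univ.val.map (f a) : Multiset γ) = univ.val.map fun p : α × β => f p.1 p.2 := by
  rw [multiset_map_eq_sum_singleton, Fintype.sum_prod_type]
  exact Finset.sum_congr rfl fun a _ => multiset_map_eq_sum_singleton _ _

/-- The supremum of `Σₘ tr((U⁽ᵐ⁾)ᵀ Z⁽ᵐ⁾ U⁽ᵐ⁾)` over partitions `R₁ + ⋯ + R_M = R`
(with `Rₘ ≤ I`) and matrices with orthonormal columns equals the sum of the `R` largest
eigenvalues in the multiset union of the eigenvalues of the `Z⁽ᵐ⁾`. -/
theorem stmt12 (M I R : ℕ) (hR : R ≤ M * I)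
    (Z P : Fin M → Matrix (Fin I) (Fin I) ℝ) (lam : Fin M → Fin I → ℝ)
    (hsym : ∀ m, (Z m)ᵀ = Z m)
    (hP : ∀ m, (P m)ᵀ * P m = 1)
    (hZ : ∀ m, Z m = P m * Matrix.diagonal (lam m) * (P m)ᵀ) :
    IsLUB {v : ℝ | ∃ Rm : Fin M → ℕ, (∑ m, Rm m) = R ∧ (∀ m, Rm m ≤ I) ∧
        ∃ Us : ∀ m : Fin M, Matrix (Fin I) (Fin (Rm m)) ℝ,
          (∀ m, (Us m)ᵀ * Us m = 1) ∧
          v = ∑ m, ((Us m)ᵀ * Z m * Us m).trace}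
      ((((∑ m, Finset.univ.val.map (lam m) : Multiset ℝ)).sort (· ≤ ·)).drop
        (M * I - R)).sum := by
  rw [sum_multiset_map_eq_map_prod]
  obtain ⟨T, t, hcard, hT, hTc, hsum⟩ := exists_threshold_finset
    (fun p : Fin M × Fin I => lam p.1 p.2) (M * I - R) (by simp)
  rw [hsum]
  replace hcard : T.card = R := by
    rw [hcard, Fintype.card_prod, Fintype.card_fin, Fintype.card_fin]
    omega
  have htr : ∀ (m : Fin M) (r : ℕ) (U : Matrix (Fin I) (Fin r) ℝ),
      (Uᵀ * Z m * U).trace = ∑ i, lam m i * (((P m)ᵀ * U) * ((P m)ᵀ * U)ᵀ) i i := by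
    intro m r U
    rw [← trace_transpose_mul_diagonal_mul, hZ]
    simp only [transpose_mul, transpose_transpose, Matrix.mul_assoc]
  refine IsGreatest.isLUB ⟨?_, ?_⟩
  · let S : Fin M → Finset (Fin I) := fun m => univ.filter fun i => (m, i) ∈ T
    have hS : ∀ g : Fin M × Fin I → ℝ, ∑ m, ∑ i ∈ S m, g (m, i) = ∑ p ∈ T, g p := by
      intro g
      simp only [S, Finset.sum_filter]
      rw [← Fintype.sum_prod_type (f := fun p => if p ∈ T then g p else 0)]
      simp
    refine ⟨fun m => (S m).card, ?_, fun m => by simpa using (S m).card_le_univ,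
      fun m => (P m).submatrix id ((S m).orderEmbOfFin rfl), fun m => ?_, ?_⟩
    · have h := hS fun _ => 1
      simp only [Finset.sum_const, nsmul_eq_mul, mul_one, hcard] at h
      exact_mod_cast h
    · rw [transpose_submatrix, ← Matrix.submatrix_mul _ _ _ _ _ Function.bijective_id, hP]
      exact Matrix.submatrix_one _ ((S m).orderEmbOfFin rfl).injective
    · rw [← hS]
      refine Finset.sum_congr rfl fun m _ => ?_
      have hPZP : (P m)ᵀ * Z m * P m = diagonal (lam m) := by
        rw [hZ, ← Matrix.mul_assoc, ← Matrix.mul_assoc, hP, Matrix.one_mul, Matrix.mul_assoc, hP,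
          Matrix.mul_one]
      have hsub : ((P m).submatrix id ((S m).orderEmbOfFin rfl))ᵀ * Z m *
          (P m).submatrix id ((S m).orderEmbOfFin rfl) =
          (diagonal (lam m)).submatrix ((S m).orderEmbOfFin rfl) ((S m).orderEmbOfFin rfl) := by
        rw [← hPZP, Matrix.submatrix_mul _ _ _ _ _ Function.bijective_id,
          Matrix.submatrix_mul _ _ _ _ _ Function.bijective_id]
        rfl
      rw [hsub]
      simp only [Matrix.trace, Matrix.diag_apply, Matrix.submatrix_apply, diagonal_apply_eq]
      rw [← Finset.sum_coe_sort (S m)]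
      exact (Equiv.sum_comp ((S m).orderIsoOfFin rfl).toEquiv fun i => lam m i).symm
  · rintro v ⟨Rm, hRm, -, Us, hU, rfl⟩
    have hV : ∀ m, ((P m)ᵀ * Us m)ᵀ * ((P m)ᵀ * Us m) = 1 := by
      intro m
      rw [transpose_mul, transpose_transpose, Matrix.mul_assoc, ← Matrix.mul_assoc (P m),
        mul_eq_one_comm.1 (hP m), Matrix.one_mul, hU]
    simp only [htr]
    rw [← Fintype.sum_prod_type (f := fun p : Fin M × Fin I => lam p.1 p.2 *
      (((P p.1)ᵀ * Us p.1) * ((P p.1)ᵀ * Us p.1)ᵀ) p.2 p.2)]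
    refine sum_mul_le_sum_of_threshold _ _ T t hT hTc
      (fun p => mul_transpose_diag_nonneg _ _) (fun p => mul_transpose_diag_le_one _ (hV _) _) ?_
    rw [Fintype.sum_prod_type, hcard, ← hRm, Nat.cast_sum]
    refine Finset.sum_congr rfl fun m _ => ?_
    change (((P m)ᵀ * Us m) * ((P m)ᵀ * Us m)ᵀ).trace = _
    rw [Matrix.trace_mul_comm, hV]
    simp
end

section
/- Let Z^(1), …, Z^(M) be real symmetric I×I matrices and let R ≤ M·I. Let N be the total number of nonnegative eigenvalues (counted with multiplicity) in the multiset union of the eigenvalues of Z^(1), …, Z^(M), and let L = min(R, N). Then the infimum, over all nonnegative integers R_1, …, R_M with R_1 + … + R_M = R and R_m ≤ I for each m, and over all U^(m) ∈ ℝ^{I×R_m} with (U^(m))ᵀU^(m) = I_{R_m} and all diagonal matrices D^(m) ∈ ℝ^{R_m×R_m} with nonnegative diagonal entries, of Σ_{m=1}^M ‖Z^(m) − U^(m) D^(m) (U^(m))ᵀ‖², equals Σ_{m=1}^M ‖Z^(m)‖² minus the sum of the squares of the L largest nonnegative eigenvalues in that multiset union. -/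
open Matrix Finset

/-- A selection of the `k` largest values of `f` on `A`, with its sum of squares. -/
theorem exists_top_subset {ι : Type*} [DecidableEq ι] (A : Finset ι) (f : ι → ℝ) (k : ℕ)
    (hk : k ≤ #A) :
    ∃ S ⊆ A, #S = k ∧ (∀ a ∈ S, ∀ b ∈ A, b ∉ S → f b ≤ f a) ∧
      ((((A.val.map f).sort (· ≤ ·)).drop (#A - k)).map (fun x => x ^ 2)).sum
        = ∑ a ∈ S, f a ^ 2 := by
  classical
  set l := A.toList.insertionSort (fun a b => f a ≤ f b) with hl
  have hperm : l.Perm A.toList := List.perm_insertionSort _ _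
  have : Std.Total (fun a b : ι => f a ≤ f b) := ⟨fun a b => le_total _ _⟩
  have : IsTrans ι (fun a b : ι => f a ≤ f b) := ⟨fun a b c => le_trans⟩
  have hsorted : l.Pairwise (fun a b => f a ≤ f b) := List.pairwise_insertionSort _ _
  have hnd : l.Nodup := hperm.nodup_iff.2 A.nodup_toList
  have hlen : l.length = #A := by rw [hperm.length_eq, Finset.length_toList]
  have hmem : ∀ a, a ∈ l ↔ a ∈ A := fun a => by rw [hperm.mem_iff, Finset.mem_toList]
  have hsort : (A.val.map f).sort (· ≤ ·) = l.map f := by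
    refine List.Perm.eq_of_pairwise' (r := (· ≤ ·)) (Multiset.pairwise_sort _ _)
      (List.pairwise_map.2 hsorted) ?_
    rw [← Multiset.coe_eq_coe, Multiset.sort_eq, ← Multiset.map_coe, Multiset.coe_eq_coe.2 hperm,
      Finset.coe_toList]
  have hdnd : (l.drop (#A - k)).Nodup := hnd.sublist (List.drop_sublist _ _)
  refine ⟨(l.drop (#A - k)).toFinset, ?_, ?_, ?_, ?_⟩
  · intro a ha
    exact (hmem a).1 (List.mem_of_mem_drop (List.mem_toFinset.1 ha))
  · rw [List.toFinset_card_of_nodup hdnd, List.length_drop, hlen]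
    omega
  · intro a ha b hb hbS
    rw [List.mem_toFinset] at ha hbS
    have hb' : b ∈ l.take (#A - k) ++ l.drop (#A - k) := by
      rw [List.take_append_drop]; exact (hmem b).2 hb
    have h := hsorted
    rw [← List.take_append_drop (#A - k) l, List.pairwise_append] at h
    exact h.2.2 b ((List.mem_append.1 hb').resolve_right hbS) a ha
  · rw [hsort, ← List.map_drop, List.map_map, List.sum_toFinset _ hdnd]
    rfl

/-- A fractional selection of total mass `R` collects at most the squared positive parts of the
`min R N` largest nonnegative values. -/
theorem sum_weight_mul_sq_posPart_le {ι : Type*} [Fintype ι] [DecidableEq ι] (f c : ι → ℝ)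
    (R : ℕ) (h0 : ∀ a, 0 ≤ c a) (h1 : ∀ a, c a ≤ 1) (hc : ∑ a, c a = R) (S : Finset ι)
    (hS : ∀ a ∈ S, 0 ≤ f a) (hcard : #S = min R #{a | 0 ≤ f a})
    (htop : ∀ a ∈ S, ∀ b, 0 ≤ f b → b ∉ S → f b ≤ f a) :
    ∑ a, c a * max (f a) 0 ^ 2 ≤ ∑ a ∈ S, f a ^ 2 := by
  have hsub : S ⊆ ({a | 0 ≤ f a} : Finset ι) := fun a ha => by simpa using hS a ha
  obtain ⟨t, hin, hout, htR⟩ : ∃ t : ℝ, (∀ a ∈ S, t ≤ max (f a) 0 ^ 2) ∧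
      (∀ b ∉ S, max (f b) 0 ^ 2 ≤ t) ∧ t * R ≤ t * #S := by
    rcases le_or_gt #{a | 0 ≤ f a} R with hNR | hRN
    · have hSeq : S = ({a | 0 ≤ f a} : Finset ι) :=
        Finset.eq_of_subset_of_card_le hsub (by rw [hcard, min_eq_right hNR])
      refine ⟨0, fun a _ => sq_nonneg _, fun b hb => ?_, by simp⟩
      have hb' : f b < 0 := by
        rw [hSeq] at hb
        simpa using hb
      rw [max_eq_right hb'.le]
      simp
    · rw [min_eq_left hRN.le] at hcard
      rcases S.eq_empty_or_nonempty with rfl | hne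
      · refine ⟨∑ a, max (f a) 0 ^ 2, by simp, fun b _ => ?_, by rw [hcard]⟩
        exact Finset.single_le_sum (f := fun a => max (f a) 0 ^ 2) (fun a _ => sq_nonneg _)
          (Finset.mem_univ b)
      · obtain ⟨a₀, ha₀, hmin⟩ := S.exists_min_image f hne
        have h₀ := hS a₀ ha₀
        refine ⟨f a₀ ^ 2, fun a ha => ?_, fun b hb => ?_, by rw [hcard]⟩
        · rw [max_eq_left (hS a ha)]
          exact pow_le_pow_left₀ h₀ (hmin a ha) 2
        · refine pow_le_pow_left₀ (le_max_right _ _) (max_le ?_ h₀) 2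
          rcases le_total 0 (f b) with h | h
          · exact htop a₀ ha₀ b h hb
          · exact h.trans h₀
  have hpt : ∀ a, c a * max (f a) 0 ^ 2 - (if a ∈ S then f a ^ 2 else 0)
      ≤ t * c a - (if a ∈ S then t else 0) := by
    intro a
    split_ifs with ha
    · have h := hin a ha
      rw [max_eq_left (hS a ha)] at h ⊢
      nlinarith [h1 a]
    · nlinarith [hout a ha, h0 a]
  have hsum := Finset.sum_le_sum fun a (_ : a ∈ Finset.univ) => hpt a
  rw [Finset.sum_sub_distrib, Finset.sum_sub_distrib, ← Finset.mul_sum, hc] at hsum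
  simp only [Finset.sum_ite_mem, Finset.univ_inter, Finset.sum_const, nsmul_eq_mul] at hsum
  linarith

theorem sum_sq_eq_trace {n : Type*} [Fintype n] (B : Matrix n n ℝ) :
    ∑ i, ∑ j, B i j ^ 2 = (B * Bᵀ).trace := by
  simp [Matrix.trace, Matrix.mul_apply, sq]

/-- The entrywise sum of squares is invariant under `A ↦ Q * A * Qᵀ` for `Q` with orthonormal
columns. -/
theorem sum_sq_mul_mul_transpose {m n : Type*} [Fintype m] [Fintype n] [DecidableEq n]
    (Q : Matrix m n ℝ) (hQ : Qᵀ * Q = 1) (A : Matrix n n ℝ) :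
    ∑ i, ∑ j, (Q * A * Qᵀ) i j ^ 2 = ∑ i, ∑ j, A i j ^ 2 := by
  rw [sum_sq_eq_trace, sum_sq_eq_trace]
  have : Q * A * Qᵀ * (Q * A * Qᵀ)ᵀ = Q * (A * (Qᵀ * Q) * Aᵀ * Qᵀ) := by
    simp only [Matrix.transpose_mul, Matrix.transpose_transpose, Matrix.mul_assoc]
  rw [this, Matrix.trace_mul_comm, hQ, Matrix.mul_one, Matrix.mul_assoc, hQ, Matrix.mul_one]

theorem sum_sq_diagonal {n : Type*} [Fintype n] [DecidableEq n] (d : n → ℝ) :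
    ∑ i, ∑ j, Matrix.diagonal d i j ^ 2 = ∑ i, d i ^ 2 := by
  refine Finset.sum_congr rfl fun i _ => ?_
  rw [Finset.sum_eq_single i] <;> simp +contextual [eq_comm]

/-- The rows of a matrix with orthonormal columns have norm at most one. -/
theorem sum_sq_row_le_one {m n : Type*} [Fintype m] [Fintype n] [DecidableEq n]
    (Q : Matrix m n ℝ) (hQ : Qᵀ * Q = 1) (i : m) : ∑ r, Q i r ^ 2 ≤ 1 := by
  have hE : (Q * Qᵀ) * (Q * Qᵀ)ᵀ = Q * Qᵀ := by
    rw [Matrix.transpose_mul, Matrix.transpose_transpose, Matrix.mul_assoc, ← Matrix.mul_assoc Qᵀ,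
      hQ, Matrix.one_mul]
  have hii : (Q * Qᵀ) i i = ∑ r, Q i r ^ 2 := by simp [Matrix.mul_apply, sq]
  have h : ∑ j, (Q * Qᵀ) i j ^ 2 = (Q * Qᵀ) i i := by
    conv_rhs => rw [← hE]
    simp only [Matrix.mul_apply (M := Q * Qᵀ), Matrix.transpose_apply, sq]
  have hle : (Q * Qᵀ) i i ^ 2 ≤ ∑ j, (Q * Qᵀ) i j ^ 2 :=
    Finset.single_le_sum (f := fun j => (Q * Qᵀ) i j ^ 2) (fun j _ => sq_nonneg _)
      (Finset.mem_univ i)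
  rw [← hii]
  nlinarith

theorem sum_sum_sq_of_orthonormal {m n : Type*} [Fintype m] [Fintype n] [DecidableEq n]
    (Q : Matrix m n ℝ) (hQ : Qᵀ * Q = 1) : ∑ i, ∑ r, Q i r ^ 2 = Fintype.card n := by
  rw [← Matrix.trace_one (n := n) (R := ℝ), ← hQ, Finset.sum_comm]
  simp [Matrix.trace, Matrix.mul_apply, sq]

/-- Lower bound for the squared distance from a diagonal matrix to `Q * diagonal d * Qᵀ`. -/
theorem sum_sq_diagonal_sub_ge {m n : Type*} [Fintype m] [Fintype n] [DecidableEq m]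
    [DecidableEq n] (lam : m → ℝ) (Q : Matrix m n ℝ) (hQ : Qᵀ * Q = 1) (d : n → ℝ)
    (hd : ∀ r, 0 ≤ d r) :
    ∑ i, lam i ^ 2 - ∑ i, (∑ r, Q i r ^ 2) * max (lam i) 0 ^ 2 ≤
      ∑ i, ∑ j, (Matrix.diagonal lam - Q * Matrix.diagonal d * Qᵀ) i j ^ 2 := by
  have hexp : ∑ i, ∑ j, (Matrix.diagonal lam - Q * Matrix.diagonal d * Qᵀ) i j ^ 2 =
      ∑ i, lam i ^ 2 - 2 * ∑ i, lam i * (Q * Matrix.diagonal d * Qᵀ) i i + ∑ r, d r ^ 2 := by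
    rw [← sum_sq_diagonal lam, ← sum_sq_diagonal d, ← sum_sq_mul_mul_transpose Q hQ,
      Finset.mul_sum, ← Finset.sum_sub_distrib, ← Finset.sum_add_distrib]
    refine Finset.sum_congr rfl fun i _ => ?_
    have h : 2 * (lam i * (Q * Matrix.diagonal d * Qᵀ) i i) =
        ∑ j, 2 * (Matrix.diagonal lam i j * (Q * Matrix.diagonal d * Qᵀ) i j) := by
      rw [Finset.sum_eq_single i] <;> simp +contextual [eq_comm]
    rw [h, ← Finset.sum_sub_distrib, ← Finset.sum_add_distrib]
    refine Finset.sum_congr rfl fun j _ => ?_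
    rw [Matrix.sub_apply]
    ring
  have hcol : ∀ r, ∑ i, Q i r ^ 2 = 1 := by
    intro r
    have h := congrFun (congrFun hQ r) r
    simpa [Matrix.mul_apply, sq] using h
  have hdiag : ∀ i, (Q * Matrix.diagonal d * Qᵀ) i i = ∑ r, d r * Q i r ^ 2 := by
    intro i
    rw [Matrix.mul_apply]
    refine Finset.sum_congr rfl fun r _ => ?_
    rw [Matrix.mul_diagonal, Matrix.transpose_apply]
    ring
  have hd2 : ∑ r, d r ^ 2 = ∑ i, ∑ r, d r ^ 2 * Q i r ^ 2 := by
    rw [Finset.sum_comm]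
    refine Finset.sum_congr rfl fun r _ => ?_
    rw [← Finset.mul_sum, hcol, mul_one]
  have hmain : 2 * ∑ i, lam i * (Q * Matrix.diagonal d * Qᵀ) i i - ∑ r, d r ^ 2 ≤
      ∑ i, (∑ r, Q i r ^ 2) * max (lam i) 0 ^ 2 := by
    rw [hd2, Finset.mul_sum, ← Finset.sum_sub_distrib]
    refine Finset.sum_le_sum fun i _ => ?_
    rw [hdiag, Finset.mul_sum, Finset.mul_sum, ← Finset.sum_sub_distrib, Finset.sum_mul]
    refine Finset.sum_le_sum fun r _ => ?_
    have h : 2 * d r * lam i - d r ^ 2 ≤ max (lam i) 0 ^ 2 := by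
      nlinarith [sq_nonneg (d r - max (lam i) 0),
        mul_le_mul_of_nonneg_left (le_max_left (lam i) 0) (hd r)]
    nlinarith [mul_le_mul_of_nonneg_left h (sq_nonneg (Q i r))]
  rw [hexp]
  linarith

/-- Compressing to a set of columns containing the support of `g` does not change
`P * diagonal g * Pᵀ`. -/
theorem submatrix_mul_diagonal_mul_transpose {m n k : Type*} [Fintype n] [Fintype k]
    [DecidableEq n] [DecidableEq k] (P : Matrix m n ℝ) (e : k ↪ n) (g : n → ℝ)
    (hg : ∀ i, i ∉ Set.range e → g i = 0) :
    P.submatrix id e * Matrix.diagonal (g ∘ e) * (P.submatrix id e)ᵀ =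
      P * Matrix.diagonal g * Pᵀ := by
  ext i j
  rw [Matrix.mul_apply, Matrix.mul_apply]
  simp only [Matrix.mul_diagonal, Matrix.transpose_apply, Matrix.submatrix_apply, id,
    Function.comp]
  refine Fintype.sum_of_injective e e.injective _ _ (fun x hx => ?_) fun _ => rfl
  rw [hg x hx]
  ring

theorem val_map_eq_sum_singleton {α β : Type*} (s : Finset α) (g : α → β) :
    s.val.map g = ∑ x ∈ s, {g x} := by
  rw [Finset.sum, ← Function.comp_def (fun c : β => ({c} : Multiset β)) g, ← Multiset.map_map,
    Multiset.sum_map_singleton]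

theorem sum_univ_map_eq_map_prod {α β γ : Type*} [Fintype α] [Fintype β] (f : α → β → γ) :
    ∑ a, (Finset.univ : Finset β).val.map (f a) =
      (Finset.univ : Finset (α × β)).val.map fun x => f x.1 x.2 := by
  simp only [val_map_eq_sum_singleton, Fintype.sum_prod_type]

/-- The infimum of `Σₘ ‖Z⁽ᵐ⁾ − U⁽ᵐ⁾ D⁽ᵐ⁾ (U⁽ᵐ⁾)ᵀ‖²` over partitions `R₁ + ⋯ + R_M = R`
(with `Rₘ ≤ I`), matrices with orthonormal columns, and diagonal `D⁽ᵐ⁾` with nonnegative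
diagonal entries equals `Σₘ ‖Z⁽ᵐ⁾‖²` minus the sum of squares of the `L = min(R, N)`
largest nonnegative eigenvalues in the multiset union of the eigenvalues of the `Z⁽ᵐ⁾`,
where `N` is the total number of nonnegative eigenvalues in that union. -/
theorem stmt14 (M I R : ℕ) (hR : R ≤ M * I)
    (Z P : Fin M → Matrix (Fin I) (Fin I) ℝ) (lam : Fin M → Fin I → ℝ)
    (hsym : ∀ m, (Z m)ᵀ = Z m)
    (hP : ∀ m, (P m)ᵀ * P m = 1)
    (hZ : ∀ m, Z m = P m * Matrix.diagonal (lam m) * (P m)ᵀ)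
    (eigs : Multiset ℝ) (heigs : eigs = ∑ m, Finset.univ.val.map (lam m))
    (N : ℕ) (hN : N = (eigs.filter (fun x => 0 ≤ x)).card)
    (L : ℕ) (hL : L = min R N) :
    IsGLB {v : ℝ | ∃ Rm : Fin M → ℕ, (∑ m, Rm m) = R ∧ (∀ m, Rm m ≤ I) ∧
        ∃ Us : ∀ m : Fin M, Matrix (Fin I) (Fin (Rm m)) ℝ,
          ∃ Ds : ∀ m : Fin M, Matrix (Fin (Rm m)) (Fin (Rm m)) ℝ,
          (∀ m, (Us m)ᵀ * Us m = 1) ∧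
          (∀ m, (Ds m).IsDiag) ∧ (∀ m r, 0 ≤ Ds m r r) ∧
          v = ∑ m, ∑ i, ∑ j, ((Z m - Us m * Ds m * (Us m)ᵀ) i j) ^ 2}
      ((∑ m, ∑ i, ∑ j, (Z m i j) ^ 2) -
        (((((eigs.filter (fun x => 0 ≤ x)).sort (· ≤ ·)).drop (N - L)).map
          (fun x => x ^ 2)).sum)) := by
  have hPT : ∀ m, P m * (P m)ᵀ = 1 := fun m => mul_eq_one_comm.1 (hP m)
  have hnorm : ∀ m, ∑ i, ∑ j, Z m i j ^ 2 = ∑ i, lam m i ^ 2 := fun m => by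
    rw [hZ m, sum_sq_mul_mul_transpose _ (hP m), sum_sq_diagonal]
  set f : Fin M × Fin I → ℝ := fun x => lam x.1 x.2 with hf
  have hfilter : eigs.filter (fun x => 0 ≤ x) =
      (({x | 0 ≤ f x} : Finset (Fin M × Fin I)).val.map f) := by
    rw [heigs, sum_univ_map_eq_map_prod, Multiset.filter_map]
    rfl
  have hNcard : N = #{x | 0 ≤ f x} := by
    rw [hN, hfilter, Multiset.card_map]
    rfl
  obtain ⟨S, hSsub, hScard, htop, hSsum⟩ :=
    exists_top_subset {x | 0 ≤ f x} f L (by rw [hL, ← hNcard]; exact min_le_right _ _)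
  have hSnonneg : ∀ x ∈ S, 0 ≤ f x := fun x hx => by simpa using hSsub hx
  rw [hfilter, hNcard, hSsum]
  simp only [hnorm]
  refine IsLeast.isGLB ⟨?_, ?_⟩
  · obtain ⟨T, hST, hTcard⟩ : ∃ T, S ⊆ T ∧ #T = R := by
      refine Finset.exists_superset_card_eq ?_ ?_
      · rw [hScard, hL]
        exact min_le_left _ _
      · simpa using hR
    set Tm : Fin M → Finset (Fin I) := fun m => {i | (m, i) ∈ T} with hTm
    set g : Fin M → Fin I → ℝ := fun m i => if (m, i) ∈ S then lam m i else 0 with hg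
    let e : ∀ m, Fin #(Tm m) ↪ Fin I := fun m => ((Tm m).orderEmbOfFin rfl).toEmbedding
    refine ⟨fun m => #(Tm m), ?_, ?_, fun m => (P m).submatrix id (e m),
      fun m => Matrix.diagonal (g m ∘ e m), ?_, ?_, ?_, ?_⟩
    · rw [← hTcard]
      simp only [hTm, Finset.card_filter, ← Fintype.sum_prod_type'
        (f := fun m i => if (m, i) ∈ T then 1 else 0)]
      simp
    · exact fun m => (Finset.card_le_univ _).trans_eq (Fintype.card_fin I)
    · intro m
      rw [Matrix.transpose_submatrix, ← Matrix.submatrix_mul _ _ _ _ _ Function.bijective_id, hP,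
        Matrix.submatrix_one _ (e m).injective]
    · exact fun m => Matrix.isDiag_diagonal _
    · intro m r
      change 0 ≤ Matrix.diagonal (g m ∘ e m) r r
      simp only [Matrix.diagonal_apply_eq, hg, Function.comp]
      split_ifs with h
      · exact hSnonneg _ h
      · exact le_rfl
    · have hblock : ∀ m, ∑ i, ∑ j, ((Z m - (P m).submatrix id (e m) *
          Matrix.diagonal (g m ∘ e m) * ((P m).submatrix id (e m))ᵀ) i j) ^ 2 =
          ∑ i, (lam m i ^ 2 - if (m, i) ∈ S then f (m, i) ^ 2 else 0) := by
        intro m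
        rw [submatrix_mul_diagonal_mul_transpose _ _ _ ?_, hZ m, ← Matrix.sub_mul,
          ← Matrix.mul_sub, sum_sq_mul_mul_transpose _ (hP m), Matrix.diagonal_sub,
          sum_sq_diagonal]
        · refine Finset.sum_congr rfl fun i _ => ?_
          simp only [hg, hf]
          split_ifs <;> ring
        · intro i hi
          have hi' : i ∉ Tm m := by
            simpa [e, Finset.range_orderEmbOfFin] using hi
          have hiS : (m, i) ∉ S := fun h => hi' (by simpa [hTm] using hST h)
          simp [hg, hiS]
      simp only [hblock, Finset.sum_sub_distrib]
      rw [← Fintype.sum_prod_type' (f := fun m i => if (m, i) ∈ S then f (m, i) ^ 2 else 0)]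
      simp
  · rintro v ⟨Rm, hRm, -, Us, Ds, hU, hDdiag, hDnonneg, rfl⟩
    set Q : ∀ m, Matrix (Fin I) (Fin (Rm m)) ℝ := fun m => (P m)ᵀ * Us m with hQdef
    have hQ : ∀ m, (Q m)ᵀ * Q m = 1 := fun m => by
      simp only [hQdef, Matrix.transpose_mul, Matrix.transpose_transpose]
      rw [Matrix.mul_assoc, ← Matrix.mul_assoc (P m), hPT, Matrix.one_mul, hU]
    have hblock : ∀ m, ∑ i, lam m i ^ 2 - ∑ i, (∑ r, Q m i r ^ 2) * max (lam m i) 0 ^ 2 ≤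
        ∑ i, ∑ j, ((Z m - Us m * Ds m * (Us m)ᵀ) i j) ^ 2 := by
      intro m
      have hD : Matrix.diagonal (fun r => Ds m r r) = Ds m := (hDdiag m).diagonal_diag
      have hUQ : Us m = P m * Q m := by
        rw [hQdef, ← Matrix.mul_assoc, hPT, Matrix.one_mul]
      have hdiff : Z m - Us m * Ds m * (Us m)ᵀ = P m * (Matrix.diagonal (lam m) -
          Q m * Matrix.diagonal (fun r => Ds m r r) * (Q m)ᵀ) * (P m)ᵀ := by
        rw [hD, hUQ, hZ m, Matrix.transpose_mul, Matrix.mul_sub, Matrix.sub_mul]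
        simp only [Matrix.mul_assoc]
      rw [hdiff, sum_sq_mul_mul_transpose _ (hP m)]
      exact sum_sq_diagonal_sub_ge _ _ (hQ m) _ (hDnonneg m)
    have hmass : ∑ x : Fin M × Fin I, ∑ r, Q x.1 x.2 r ^ 2 = (R : ℝ) := by
      rw [Fintype.sum_prod_type, ← hRm, Nat.cast_sum]
      refine Finset.sum_congr rfl fun m _ => ?_
      rw [sum_sum_sq_of_orthonormal _ (hQ m), Fintype.card_fin]
    have hweight := sum_weight_mul_sq_posPart_le f (fun x => ∑ r, Q x.1 x.2 r ^ 2) R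
      (fun x => Finset.sum_nonneg fun r _ => sq_nonneg _)
      (fun x => sum_sq_row_le_one _ (hQ x.1) x.2) hmass S hSnonneg
      (by rw [hScard, hL, hNcard]) (fun a ha b hb hbS => htop a ha b (by simpa using hb) hbS)
    rw [Fintype.sum_prod_type] at hweight
    have hsum := Finset.sum_le_sum fun m (_ : m ∈ Finset.univ) => hblock m
    rw [Finset.sum_sub_distrib] at hsum
    linarith
end
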